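/- The number of extremal rays of the Kostka cone Kostka_r equals C(r,3) + C(r,2) + C(r,1), where C denotes the binomial coefficient. -/

import Mathlib

/-- Membership in the Kostka cone `Kostka_r ⊆ ℝ^{2r}`. -/
def InKostkaCone (r : ℕ) (lam mu : Fin r → ℝ) : Prop :=
  (∀ i j : Fin r, i ≤ j → lam j ≤ lam i) ∧
  (∀ i j : Fin r, i ≤ j → mu j ≤ mu i) ∧
  (∀ i, 0 ≤ lam i) ∧ (∀ i, 0 ≤ mu i) ∧
  (∀ t, 1 ≤ t → t ≤ r - 1 →
    (∑ i : Fin r, if (i : ℕ) < t then mu i else 0) ≤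
      ∑ i : Fin r, if (i : ℕ) < t then lam i else 0) ∧
  (∑ i, lam i = ∑ i, mu i)

/-- An extremal ray of the Kostka cone: the set of positive multiples of a nonzero cone
element all of whose decompositions into two cone elements have summands that are
nonnegative multiples of it. -/
def IsExtremalRayOfKostka (r : ℕ) (R : Set ((Fin r → ℝ) × (Fin r → ℝ))) : Prop :=
  ∃ v : (Fin r → ℝ) × (Fin r → ℝ), InKostkaCone r v.1 v.2 ∧ v ≠ 0 ∧
    (∀ x y : (Fin r → ℝ) × (Fin r → ℝ), InKostkaCone r x.1 x.2 → InKostkaCone r y.1 y.2 →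
      v = x + y → ∃ c : ℝ, 0 ≤ c ∧ x = c • v) ∧
    R = {w | ∃ c : ℝ, 0 < c ∧ w = c • v}

open Finset Filter Topology

/-- Extension of a finite tuple by zeros. -/
def zeroExtend {r : ℕ} (f : Fin r → ℝ) (i : ℕ) : ℝ := if h : i < r then f ⟨i, h⟩ else 0

/-- The Kostka cone in terms of sequences that vanish from the index `r` on. -/
structure KostkaPair (r : ℕ) (f g : ℕ → ℝ) : Prop where
  anti_left : Antitone f
  anti_right : Antitone g
  left_eq_zero : ∀ i, r ≤ i → f i = 0
  right_eq_zero : ∀ i, r ≤ i → g i = 0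
  sum_le : ∀ t, ∑ i ∈ range t, g i ≤ ∑ i ∈ range t, f i
  sum_eq : ∑ i ∈ range r, f i = ∑ i ∈ range r, g i

lemma zeroExtend_of_le {r : ℕ} (f : Fin r → ℝ) {i : ℕ} (h : r ≤ i) : zeroExtend f i = 0 := by
  simp [zeroExtend, h]

lemma zeroExtend_val {r : ℕ} (f : Fin r → ℝ) (i : Fin r) : zeroExtend f i = f i := by
  simp [zeroExtend]

lemma zeroExtend_restrict {r : ℕ} (f : ℕ → ℝ) (h : ∀ i, r ≤ i → f i = 0) :
    zeroExtend (fun i : Fin r => f i) = f := by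
  ext i
  by_cases hi : i < r
  · simp [zeroExtend, hi]
  · simp [zeroExtend, hi, h i (not_lt.1 hi)]

lemma sum_range_of_le {r : ℕ} {f : ℕ → ℝ} (h : ∀ i, r ≤ i → f i = 0) {t : ℕ} (ht : r ≤ t) :
    ∑ i ∈ range t, f i = ∑ i ∈ range r, f i := by
  symm
  apply sum_subset (range_mono ht)
  intro i _ hi
  exact h i (by simpa using hi)

lemma sum_fin_ite_lt {r : ℕ} (f : Fin r → ℝ) (t : ℕ) (ht : t ≤ r) :
    (∑ i : Fin r, if (i : ℕ) < t then f i else 0) = ∑ i ∈ range t, zeroExtend f i := by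
  have h : ∀ i : Fin r, (if (i : ℕ) < t then f i else 0) =
      (fun j : ℕ => if j < t then zeroExtend f j else 0) i := by
    intro i
    simp [zeroExtend_val]
  rw [sum_congr rfl fun i _ => h i,
    Fin.sum_univ_eq_sum_range (fun j : ℕ => if j < t then zeroExtend f j else 0), ← sum_filter]
  congr 1
  ext j
  simp only [mem_filter, mem_range]
  omega

lemma sum_fin_eq {r : ℕ} (f : Fin r → ℝ) : ∑ i, f i = ∑ i ∈ range r, zeroExtend f i := by
  rw [← Fin.sum_univ_eq_sum_range]
  simp [zeroExtend_val]

lemma antitone_zeroExtend {r : ℕ} {f : Fin r → ℝ} (h : ∀ i j : Fin r, i ≤ j → f j ≤ f i)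
    (h0 : ∀ i, 0 ≤ f i) : Antitone (zeroExtend f) := by
  intro i j hij
  by_cases hj : j < r
  · have hi : i < r := by omega
    simpa [zeroExtend, hi, hj] using h ⟨i, hi⟩ ⟨j, hj⟩ hij
  · rw [zeroExtend_of_le f (not_lt.1 hj)]
    by_cases hi : i < r
    · simpa [zeroExtend, hi] using h0 ⟨i, hi⟩
    · simp [zeroExtend, hi]

lemma inKostkaCone_iff {r : ℕ} (f g : Fin r → ℝ) :
    InKostkaCone r f g ↔ KostkaPair r (zeroExtend f) (zeroExtend g) := by
  constructor
  · rintro ⟨hf, hg, hf0, hg0, hle, heq⟩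
    rw [sum_fin_eq, sum_fin_eq] at heq
    refine ⟨antitone_zeroExtend hf hf0, antitone_zeroExtend hg hg0,
      fun i => zeroExtend_of_le f, fun i => zeroExtend_of_le g, fun t => ?_, heq⟩
    rcases le_or_gt r t with ht | ht
    · rw [sum_range_of_le (fun i => zeroExtend_of_le f) ht,
        sum_range_of_le (fun i => zeroExtend_of_le g) ht, heq]
    · rcases Nat.eq_zero_or_pos t with rfl | h0
      · simp
      · rw [← sum_fin_ite_lt f t ht.le, ← sum_fin_ite_lt g t ht.le]
        exact hle t h0 (by omega)
  · rintro ⟨hf, hg, hf0, hg0, hle, heq⟩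
    refine ⟨fun i j hij => ?_, fun i j hij => ?_, fun i => ?_, fun i => ?_, fun t h0 ht => ?_, ?_⟩
    · simpa [zeroExtend_val] using hf (show (i : ℕ) ≤ j from hij)
    · simpa [zeroExtend_val] using hg (show (i : ℕ) ≤ j from hij)
    · simpa [zeroExtend_val, hf0] using hf i.2.le
    · simpa [zeroExtend_val, hg0] using hg i.2.le
    · rw [sum_fin_ite_lt f t (by omega), sum_fin_ite_lt g t (by omega)]
      exact hle t
    · rw [sum_fin_eq, sum_fin_eq, heq]

lemma eventually_mul_le (N : ℕ) (a b : ℕ → ℝ) (hb : ∀ i, 0 ≤ b i)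
    (h : ∀ i, 0 < a i → 0 < b i) :
    ∀ᶠ ε in 𝓝[>] (0 : ℝ), ∀ i ∈ range N, ε * a i ≤ b i := by
  rw [eventually_all_finset]
  intro i _
  rcases (hb i).eq_or_lt with h0 | h0
  · have ha : a i ≤ 0 := by
      by_contra! hc
      exact (h i hc).ne h0
    filter_upwards [self_mem_nhdsWithin] with ε hε
    rw [← h0]
    exact mul_nonpos_of_nonneg_of_nonpos (le_of_lt hε) ha
  · have ht : Tendsto (fun ε : ℝ => ε * a i) (𝓝[>] 0) (𝓝 (0 * a i)) :=
      ((continuous_mul_const (a i)).tendsto 0).mono_left nhdsWithin_le_nhds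
    rw [zero_mul] at ht
    filter_upwards [ht.eventually_lt_const h0] with ε hε using hε.le

lemma KostkaPair.exists_sub {r : ℕ} {f g F G : ℕ → ℝ} (hv : KostkaPair r f g)
    (hw : KostkaPair r F G) (hF : ∀ i, F (i + 1) < F i → f (i + 1) < f i)
    (hG : ∀ i, G (i + 1) < G i → g (i + 1) < g i)
    (hS : ∀ t, ∑ i ∈ range t, G i < ∑ i ∈ range t, F i →
      ∑ i ∈ range t, g i < ∑ i ∈ range t, f i) :
    ∃ ε > 0, KostkaPair r (fun i => f i - ε * F i) (fun i => g i - ε * G i) := by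
  have e₁ := eventually_mul_le r (fun i => F i - F (i + 1)) (fun i => f i - f (i + 1))
    (fun i => sub_nonneg.2 (hv.anti_left i.le_succ)) (fun i h => sub_pos.2 (hF i (sub_pos.1 h)))
  have e₂ := eventually_mul_le r (fun i => G i - G (i + 1)) (fun i => g i - g (i + 1))
    (fun i => sub_nonneg.2 (hv.anti_right i.le_succ)) (fun i h => sub_pos.2 (hG i (sub_pos.1 h)))
  have e₃ := eventually_mul_le r (fun t => ∑ i ∈ range t, F i - ∑ i ∈ range t, G i)
    (fun t => ∑ i ∈ range t, f i - ∑ i ∈ range t, g i)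
    (fun t => sub_nonneg.2 (hv.sum_le t)) (fun t h => sub_pos.2 (hS t (sub_pos.1 h)))
  obtain ⟨ε, ⟨⟨h₁, h₂⟩, h₃⟩, hε⟩ := (((e₁.and e₂).and e₃).and self_mem_nhdsWithin).exists
  simp only [mem_range] at h₁ h₂ h₃
  have hf0 : ∀ i, r ≤ i → f i - ε * F i = 0 := fun i hi => by
    simp [hv.left_eq_zero i hi, hw.left_eq_zero i hi]
  have hg0 : ∀ i, r ≤ i → g i - ε * G i = 0 := fun i hi => by
    simp [hv.right_eq_zero i hi, hw.right_eq_zero i hi]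
  have heq : ∑ i ∈ range r, (f i - ε * F i) = ∑ i ∈ range r, (g i - ε * G i) := by
    rw [sum_sub_distrib, sum_sub_distrib, ← mul_sum, ← mul_sum, hv.sum_eq, hw.sum_eq]
  refine ⟨ε, hε, antitone_nat_of_succ_le fun i => ?_, antitone_nat_of_succ_le fun i => ?_,
    hf0, hg0, fun t => ?_, heq⟩
  · rcases lt_or_ge i r with hi | hi
    · linarith [h₁ i hi]
    · rw [hf0 i hi, hf0 (i + 1) (by omega)]
  · rcases lt_or_ge i r with hi | hi
    · linarith [h₂ i hi]
    · rw [hg0 i hi, hg0 (i + 1) (by omega)]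
  · rcases lt_or_ge t r with ht | ht
    · rw [sum_sub_distrib, sum_sub_distrib, ← mul_sum, ← mul_sum]
      linarith [h₃ t ht]
    · rw [sum_range_of_le hf0 ht, sum_range_of_le hg0 ht, heq]

/-- The fundamental weight `(1^m, 0, 0, …)`. -/
def weight (m i : ℕ) : ℝ := if i < m then 1 else 0

/-- The coefficient `q` for which `m = (1 - q) * l + q * n`. -/
noncomputable def ratio (l m n : ℕ) : ℝ := ((m : ℝ) - l) / ((n : ℝ) - l)

/-- The sequence `(1^l, q^(n - l), 0, 0, …)` with sum `m`. -/
noncomputable def interp (l m n i : ℕ) : ℝ :=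
  (1 - ratio l m n) * weight l i + ratio l m n * weight n i

/-- The index triples of the extremal rays. -/
def IsRayIndex (r l m n : ℕ) : Prop :=
  0 < m ∧ n ≤ r ∧ (l < m ∧ m < n ∨ l = m ∧ m = n)

lemma sum_weight (m t : ℕ) : ∑ i ∈ range t, weight m i = ((min t m : ℕ) : ℝ) := by
  simp only [weight]
  rw [← sum_filter, sum_const, nsmul_eq_mul, mul_one]
  congr 1
  rw [← card_range (min t m)]
  congr 1
  ext i
  simp

lemma sum_interp (l m n t : ℕ) : ∑ i ∈ range t, interp l m n i =
    (1 - ratio l m n) * ((min t l : ℕ) : ℝ) + ratio l m n * ((min t n : ℕ) : ℝ) := by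
  simp only [interp]
  rw [sum_add_distrib, ← mul_sum, ← mul_sum, sum_weight, sum_weight]

lemma antitone_weight (m : ℕ) : Antitone (weight m) := by
  intro i j hij
  simp only [weight]
  split_ifs
  · rfl
  · omega
  · norm_num
  · rfl

lemma weight_sub_succ (m i : ℕ) : weight m i - weight m (i + 1) = if i + 1 = m then 1 else 0 := by
  simp only [weight]
  split_ifs <;> first | omega | norm_num

namespace IsRayIndex

variable {r l m n : ℕ}

lemma ratio_mul (h : IsRayIndex r l m n) :
    (1 - ratio l m n) * (l : ℝ) + ratio l m n * n = m := by
  obtain ⟨-, -, ⟨h1, h2⟩ | ⟨rfl, rfl⟩⟩ := h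
  · have : (n : ℝ) - l ≠ 0 := sub_ne_zero.2 (by exact_mod_cast (h1.trans h2).ne')
    simp only [ratio]
    field_simp
    ring
  · ring

lemma ratio_nonneg (h : IsRayIndex r l m n) : 0 ≤ ratio l m n := by
  obtain ⟨-, -, h⟩ := h
  have h1 : (l : ℝ) ≤ m := by exact_mod_cast (by omega : l ≤ m)
  have h2 : (l : ℝ) ≤ n := by exact_mod_cast (by omega : l ≤ n)
  exact div_nonneg (sub_nonneg.2 h1) (sub_nonneg.2 h2)

lemma ratio_lt_one (h : IsRayIndex r l m n) : ratio l m n < 1 := by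
  obtain ⟨-, -, ⟨h1, h2⟩ | ⟨rfl, rfl⟩⟩ := h
  · have h1 : (l : ℝ) < m := by exact_mod_cast h1
    have h2 : (m : ℝ) < n := by exact_mod_cast h2
    rw [ratio, div_lt_one (by linarith)]
    linarith
  · simp [ratio]

lemma ratio_pos (h : IsRayIndex r l m n) (hl : l < m) : 0 < ratio l m n := by
  obtain ⟨-, -, h⟩ := h
  have h1 : (l : ℝ) < m := by exact_mod_cast hl
  have h2 : (l : ℝ) < n := by exact_mod_cast (by omega : l < n)
  exact div_pos (sub_pos.2 h1) (sub_pos.2 h2)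

lemma sum_sub_eq_zero (h : IsRayIndex r l m n) {t : ℕ} (ht : t ≤ l ∨ n ≤ t) :
    ∑ i ∈ range t, interp l m n i = ∑ i ∈ range t, weight m i := by
  have hq := h.ratio_mul
  obtain ⟨-, -, h⟩ := h
  rw [sum_weight, sum_interp]
  rcases ht with ht | ht
  · rw [min_eq_left ht, min_eq_left (by omega : t ≤ n), min_eq_left (by omega : t ≤ m)]
    ring
  · rw [min_eq_right ht, min_eq_right (by omega : l ≤ t), min_eq_right (by omega : m ≤ t), hq]

lemma kostkaPair (h : IsRayIndex r l m n) : KostkaPair r (weight m) (interp l m n) := by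
  have hq := h.ratio_mul
  have h0 := h.ratio_nonneg
  have h1 := h.ratio_lt_one
  have hr := h.2.1
  have hlm : l ≤ m ∧ m ≤ n := by have := h.2.2; omega
  refine ⟨antitone_weight m, fun i j hij => ?_, fun i hi => ?_, fun i hi => ?_, fun t => ?_,
    (h.sum_sub_eq_zero (Or.inr hr)).symm⟩
  · have a := antitone_weight l hij
    have b := antitone_weight n hij
    simp only [interp]
    exact add_le_add (mul_le_mul_of_nonneg_left a (by linarith))
      (mul_le_mul_of_nonneg_left b h0)
  · simp only [weight, if_neg (by omega : ¬ i < m)]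
  · simp [interp, weight, if_neg (by omega : ¬ i < l), if_neg (by omega : ¬ i < n)]
  · by_cases ht : t ≤ l ∨ n ≤ t
    · exact (h.sum_sub_eq_zero ht).le
    · push Not at ht
      rw [sum_weight, sum_interp, min_eq_right ht.1.le, min_eq_left ht.2.le]
      have a : (l : ℝ) ≤ t := by exact_mod_cast ht.1.le
      have b : (t : ℝ) ≤ n := by exact_mod_cast ht.2.le
      rcases le_total t m with c | c
      · rw [min_eq_left c]
        nlinarith
      · rw [min_eq_right c]
        nlinarith

lemma interp_eq_one_iff (h : IsRayIndex r l m n) (i : ℕ) : interp l m n i = 1 ↔ i < l := by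
  have h1 := h.ratio_lt_one
  have hlm : l ≤ n := by have := h.2.2; omega
  simp only [interp, weight]
  split_ifs
  · simp [*]
  · omega
  · simp [*, h1.ne]
  · simp [*]

lemma interp_pos_iff (h : IsRayIndex r l m n) (i : ℕ) : 0 < interp l m n i ↔ i < n := by
  have h0 := h.2.2
  have h1 := h.ratio_pos
  simp only [interp, weight]
  split_ifs
  · simp [*]
  · omega
  · have := h1 (by omega)
    simp [*]
  · simp [*]

end IsRayIndex

lemma KostkaPair.nonneg_left {r : ℕ} {f g : ℕ → ℝ} (hv : KostkaPair r f g) (i : ℕ) : 0 ≤ f i := by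
  rw [← hv.left_eq_zero (max i r) (le_max_right _ _)]
  exact hv.anti_left (le_max_left _ _)

lemma KostkaPair.nonneg_right {r : ℕ} {f g : ℕ → ℝ} (hv : KostkaPair r f g) (i : ℕ) :
    0 ≤ g i := by
  rw [← hv.right_eq_zero (max i r) (le_max_right _ _)]
  exact hv.anti_right (le_max_left _ _)

lemma KostkaPair.eq_of_sum_eq {r : ℕ} {f g : ℕ → ℝ} (hv : KostkaPair r f g) {t : ℕ}
    (ht : ∑ i ∈ range (t + 1), g i = ∑ i ∈ range (t + 1), f i) (hg : g t ≤ g (t + 1)) :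
    f t = g t ∧ f (t + 1) = g (t + 1) ∧ f t = f (t + 1) := by
  have h0 := hv.sum_le t
  have h2 := hv.sum_le (t + 2)
  have hf := hv.anti_left t.le_succ
  rw [sum_range_succ _ (t + 1), sum_range_succ _ (t + 1), ht] at h2
  rw [sum_range_succ, sum_range_succ] at ht
  simp only [Nat.succ_eq_add_one] at hf
  refine ⟨?_, ?_, ?_⟩ <;> linarith

lemma exists_drop {f : ℕ → ℝ} {k j : ℕ} (hkj : k ≤ j) (h : f j < f k) :
    ∃ i, k ≤ i ∧ f (i + 1) < f i := by
  by_contra! hc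
  have : ∀ i, k ≤ i → f k ≤ f i := fun i hi =>
    Nat.le_induction le_rfl (fun a ha ih => ih.trans (hc a ha)) i hi
  exact (this j hkj).not_gt h

lemma KostkaPair.exists_isRayIndex {r : ℕ} {f g : ℕ → ℝ} (hv : KostkaPair r f g)
    (h0 : ∃ i, 0 < f i) :
    ∃ l m n, IsRayIndex r l m n ∧ (∀ i, i + 1 = m → f (i + 1) < f i) ∧
      (∀ i, i + 1 = l ∨ i + 1 = n → g (i + 1) < g i) ∧
      ∀ t, l < t → t < n → ∑ i ∈ range t, g i < ∑ i ∈ range t, f i := by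
  classical
  obtain ⟨a, ha⟩ := h0
  obtain ⟨k, -, hk⟩ : ∃ k, a ≤ k ∧ f (k + 1) < f k :=
    exists_drop (le_max_left a r) (by rwa [hv.left_eq_zero _ (le_max_right _ _)])
  have hkr : k < r := by
    by_contra! hc
    rw [hv.left_eq_zero k hc, hv.left_eq_zero (k + 1) (by omega)] at hk
    exact lt_irrefl _ hk
  by_cases hgk : g (k + 1) < g k
  · refine ⟨k + 1, k + 1, k + 1, ⟨by omega, hkr, Or.inr ⟨rfl, rfl⟩⟩, ?_, ?_, ?_⟩
    · rintro i hi
      obtain rfl : i = k := by omega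
      exact hk
    · rintro i hi
      obtain rfl : i = k := by omega
      exact hgk
    · intro t h1 h2
      omega
  rw [not_lt] at hgk
  have hDk : ∑ i ∈ range (k + 1), g i < ∑ i ∈ range (k + 1), f i := by
    refine lt_of_le_of_ne (hv.sum_le _) fun h => ?_
    exact hk.ne' (hv.eq_of_sum_eq h hgk).2.2
  have hj : ∃ j, k ≤ j ∧ g (j + 1) < g j := by
    by_contra! hc
    have hz : ∀ i, k + 1 ≤ i → g i = 0 := by
      intro i hi
      by_contra hne
      have hpos := lt_of_le_of_ne (hv.nonneg_right i) (Ne.symm hne)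
      obtain ⟨j, hj, hlt⟩ := exists_drop (f := g) (le_max_left i r)
        (by rwa [hv.right_eq_zero _ (le_max_right _ _)])
      exact (hc j (by omega)).not_gt hlt
    have h1 := sum_range_of_le hz (show k + 1 ≤ r from hkr)
    have h2 : ∑ i ∈ range (k + 1), f i ≤ ∑ i ∈ range r, f i :=
      sum_le_sum_of_subset_of_nonneg (range_mono hkr) fun i _ _ => hv.nonneg_left i
    rw [hv.sum_eq, h1] at h2
    exact h2.not_gt hDk
  obtain ⟨hkj, hgj⟩ := Nat.find_spec hj
  have hmin := fun i => Nat.find_min hj (m := i)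
  set j := Nat.find hj
  let P : ℕ → Prop := fun l => ∀ i, i + 1 = l → g (i + 1) < g i
  have hP0 : P 0 := fun i hi => by omega
  have hl := Nat.findGreatest_spec (P := P) (Nat.zero_le k) hP0
  have hlk := Nat.findGreatest_le (P := P) k
  have hmax : ∀ i, Nat.findGreatest P k < i → i ≤ k → ¬ P i :=
    fun i => Nat.findGreatest_is_greatest
  set l := Nat.findGreatest P k
  have hjr : j < r := by
    by_contra! hc
    rw [hv.right_eq_zero j hc, hv.right_eq_zero (j + 1) (by omega)] at hgj
    exact lt_irrefl _ hgj
  have hjk : k ≠ j := fun h => (h ▸ hgk).not_gt hgj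
  have hflat : ∀ t, l ≤ t → t < j → g t ≤ g (t + 1) := by
    intro t h1 h2
    rcases le_or_gt k t with h3 | h3
    · by_contra! hc
      exact hmin t h2 ⟨h3, hc⟩
    · by_contra! hc
      refine hmax (t + 1) (by omega) (by omega) fun i hi => ?_
      obtain rfl : i = t := by omega
      exact hc
  refine ⟨l, k + 1, j + 1, ⟨by omega, hjr, Or.inl ⟨by omega, by omega⟩⟩, ?_, ?_, ?_⟩
  · rintro i hi
    obtain rfl : i = k := by omega
    exact hk
  · rintro i (hi | hi)
    · exact hl i hi
    · obtain rfl : i = j := by omega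
      exact hgj
  · intro t h1 h2
    rcases le_total (k + 1) t with h3 | h3
    · induction t, h3 using Nat.le_induction with
      | base => exact hDk
      | succ t ht ih =>
        refine lt_of_le_of_ne (hv.sum_le _) fun h => ?_
        have h4 := (hv.eq_of_sum_eq h (hflat t (by omega) (by omega))).1
        have h5 := ih (by omega) (by omega)
        rw [sum_range_succ, sum_range_succ, h4] at h
        linarith
    · induction h3 using Nat.decreasingInduction with
      | self => exact hDk
      | of_succ t ht ih =>
        refine lt_of_le_of_ne (hv.sum_le _) fun h => ?_
        obtain ⟨s, rfl⟩ : ∃ s, t = s + 1 := ⟨t - 1, by omega⟩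
        have h4 := (hv.eq_of_sum_eq h (hflat s (by omega) (by omega))).2.1
        have h5 := ih (by omega) (by omega)
        rw [sum_range_succ, sum_range_succ _ (s + 1), h4] at h5
        linarith

lemma KostkaPair.exists_sub_ray {r : ℕ} {f g : ℕ → ℝ} (hv : KostkaPair r f g)
    (h0 : ∃ i, 0 < f i) :
    ∃ l m n, IsRayIndex r l m n ∧ ∃ ε > 0,
      KostkaPair r (fun i => f i - ε * weight m i) (fun i => g i - ε * interp l m n i) := by
  obtain ⟨l, m, n, h, hf, hg, hS⟩ := hv.exists_isRayIndex h0
  refine ⟨l, m, n, h, hv.exists_sub h.kostkaPair (fun i hi => hf i ?_) (fun i hi => hg i ?_)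
    fun t ht => ?_⟩
  · by_contra hc
    have := weight_sub_succ m i
    rw [if_neg hc] at this
    linarith
  · by_contra! hc
    have h1 := weight_sub_succ l i
    have h2 := weight_sub_succ n i
    rw [if_neg hc.1] at h1
    rw [if_neg hc.2] at h2
    simp only [interp] at hi
    rw [sub_eq_zero.1 h1, sub_eq_zero.1 h2] at hi
    exact lt_irrefl _ hi
  · by_cases hc : t ≤ l ∨ n ≤ t
    · exact absurd (h.sum_sub_eq_zero hc) ht.ne
    · push Not at hc
      exact hS t hc.1 hc.2

lemma IsRayIndex.extremal {r l m n : ℕ} (h : IsRayIndex r l m n) {f g f' g' : ℕ → ℝ}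
    (hv : KostkaPair r f g) (hv' : KostkaPair r f' g') (hf : ∀ i, f i + f' i = weight m i)
    (hg : ∀ i, g i + g' i = interp l m n i) :
    ∃ c, 0 ≤ c ∧ (∀ i, f i = c * weight m i) ∧ ∀ i, g i = c * interp l m n i := by
  have hlm : l ≤ m ∧ m ≤ n := by have := h.2.2; omega
  have hf' : ∀ i, f i = f 0 * weight m i := by
    intro i
    have h0 := hf 0
    have hi := hf i
    have a := hv.anti_left (Nat.zero_le i)
    have a' := hv'.anti_left (Nat.zero_le i)
    have b := hv.nonneg_left i
    have b' := hv'.nonneg_left i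
    by_cases him : i < m
    · simp only [weight, if_pos him, if_pos h.1] at h0 hi ⊢
      linarith
    · simp only [weight, if_neg him] at hi ⊢
      linarith
  have hg' : ∀ i, g i = g 0 * weight l i + g l * (weight n i - weight l i) := by
    intro i
    have h0 := hg 0
    have hl := hg l
    have hi := hg i
    have a := hv.anti_right (Nat.zero_le i)
    have a' := hv'.anti_right (Nat.zero_le i)
    have b := hv.nonneg_right i
    have b' := hv'.nonneg_right i
    by_cases hil : i < l
    · simp only [interp, weight, if_pos hil, if_pos (by omega : i < n), if_pos (by omega : 0 < l),
        if_pos (by omega : 0 < n)] at h0 hi ⊢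
      linarith
    · have c := hv.anti_right (not_lt.1 hil)
      have c' := hv'.anti_right (not_lt.1 hil)
      by_cases hin : i < n
      · simp only [interp, weight, if_neg hil, if_pos hin, if_pos (by omega : l < n),
          if_neg (lt_irrefl l)] at hl hi ⊢
        linarith
      · simp only [interp, weight, if_neg hil, if_neg hin] at hi ⊢
        linarith
  have hSf : ∀ t, ∑ i ∈ range t, f i = f 0 * ((min t m : ℕ) : ℝ) := by
    intro t
    rw [sum_congr rfl fun i _ => hf' i, ← mul_sum, sum_weight]
  have hSg : ∀ t, ∑ i ∈ range t, g i =
      g 0 * ((min t l : ℕ) : ℝ) + g l * (((min t n : ℕ) : ℝ) - ((min t l : ℕ) : ℝ)) := by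
    intro t
    rw [sum_congr rfl fun i _ => hg' i, sum_add_distrib, ← mul_sum, ← mul_sum, sum_sub_distrib,
      sum_weight, sum_weight]
  have hl : f 0 * (l : ℝ) = g 0 * l := by
    have e := h.sum_sub_eq_zero (Or.inl le_rfl : l ≤ l ∨ n ≤ l)
    rw [← sum_congr rfl fun i _ => hf i, ← sum_congr rfl fun i _ => hg i, sum_add_distrib,
      sum_add_distrib] at e
    have a := hv.sum_le l
    have a' := hv'.sum_le l
    have e' : ∑ i ∈ range l, f i = ∑ i ∈ range l, g i := by linarith
    rw [hSf, hSg, min_self, min_eq_left hlm.1, min_eq_left (hlm.1.trans hlm.2)] at e'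
    linarith
  have hr : f 0 * (m : ℝ) = g 0 * l + g l * (n - l) := by
    have e := hv.sum_eq
    have := h.2.1
    rwa [hSf, hSg, min_eq_right (by omega : m ≤ r), min_eq_right (by omega : l ≤ r),
      min_eq_right (by omega : n ≤ r)] at e
  have hl' : ∀ i, g 0 * weight l i = f 0 * weight l i := by
    intro i
    rcases Nat.eq_zero_or_pos l with h0 | h0
    · simp [weight, h0]
    · have : (l : ℝ) ≠ 0 := by exact_mod_cast h0.ne'
      rw [mul_right_cancel₀ this hl]
  refine ⟨f 0, hv.nonneg_left 0, hf', fun i => ?_⟩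
  rw [hg', hl']
  have hq := h.ratio_mul
  obtain ⟨-, -, ⟨h1, h2⟩ | ⟨rfl, rfl⟩⟩ := h
  · have hn : (n : ℝ) - l ≠ 0 := sub_ne_zero.2 (by exact_mod_cast (h1.trans h2).ne')
    have e : g l = f 0 * ratio l m n := by
      apply mul_right_cancel₀ hn
      linear_combination -hr + hl - f 0 * hq
    rw [e, interp]
    ring
  · simp only [interp]
    ring

/-- The generator of the extremal ray with the given indices. -/
noncomputable def generator (r l m n : ℕ) : (Fin r → ℝ) × (Fin r → ℝ) :=
  (fun i => weight m i, fun i => interp l m n i)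

/-- The ray through `v`. -/
def openRay {r : ℕ} (v : (Fin r → ℝ) × (Fin r → ℝ)) : Set ((Fin r → ℝ) × (Fin r → ℝ)) :=
  {w | ∃ c : ℝ, 0 < c ∧ w = c • v}

lemma openRay_smul {r : ℕ} (v : (Fin r → ℝ) × (Fin r → ℝ)) {c : ℝ} (hc : 0 < c) :
    openRay (c • v) = openRay v := by
  ext w
  constructor
  · rintro ⟨d, hd, rfl⟩
    exact ⟨d * c, mul_pos hd hc, smul_smul _ _ _⟩
  · rintro ⟨d, hd, rfl⟩
    refine ⟨d / c, div_pos hd hc, ?_⟩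
    rw [smul_smul, div_mul_cancel₀ _ hc.ne']

lemma zeroExtend_add {r : ℕ} (f g : Fin r → ℝ) (i : ℕ) :
    zeroExtend (f + g) i = zeroExtend f i + zeroExtend g i := by
  by_cases hi : i < r <;> simp [zeroExtend, hi]

lemma IsRayIndex.zeroExtend_weight {r l m n : ℕ} (h : IsRayIndex r l m n) :
    zeroExtend (generator r l m n).1 = weight m :=
  zeroExtend_restrict _ h.kostkaPair.left_eq_zero

lemma IsRayIndex.zeroExtend_interp {r l m n : ℕ} (h : IsRayIndex r l m n) :
    zeroExtend (generator r l m n).2 = interp l m n :=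
  zeroExtend_restrict _ h.kostkaPair.right_eq_zero

lemma IsRayIndex.inKostkaCone {r l m n : ℕ} (h : IsRayIndex r l m n) :
    InKostkaCone r (generator r l m n).1 (generator r l m n).2 := by
  rw [inKostkaCone_iff, h.zeroExtend_weight, h.zeroExtend_interp]
  exact h.kostkaPair

lemma IsRayIndex.pos {r l m n : ℕ} (h : IsRayIndex r l m n) : 0 < r := by
  obtain ⟨h1, h2, h3⟩ := h
  omega

lemma IsRayIndex.generator_ne_zero {r l m n : ℕ} (h : IsRayIndex r l m n) :
    generator r l m n ≠ 0 := by
  intro h0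
  have := congrFun (congrArg Prod.fst h0) ⟨0, h.pos⟩
  simp [generator, weight, h.1] at this

lemma IsRayIndex.isExtremalRay {r l m n : ℕ} (h : IsRayIndex r l m n) :
    IsExtremalRayOfKostka r (openRay (generator r l m n)) := by
  refine ⟨generator r l m n, h.inKostkaCone, h.generator_ne_zero, fun x y hx hy hxy => ?_, rfl⟩
  rw [inKostkaCone_iff] at hx hy
  obtain ⟨c, hc, h1, h2⟩ := h.extremal hx hy
    (fun i => by rw [← zeroExtend_add, ← h.zeroExtend_weight, hxy]; rfl)
    (fun i => by rw [← zeroExtend_add, ← h.zeroExtend_interp, hxy]; rfl)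
  refine ⟨c, hc, Prod.ext (funext fun i => ?_) (funext fun i => ?_)⟩
  · simpa [zeroExtend_val, generator] using h1 i
  · simpa [zeroExtend_val, generator] using h2 i

lemma KostkaPair.exists_pos {r : ℕ} {f g : ℕ → ℝ} (hv : KostkaPair r f g)
    (h0 : ∃ i, f i ≠ 0 ∨ g i ≠ 0) : ∃ i, 0 < f i := by
  by_contra! hc
  have hf : ∀ i, f i = 0 := fun i => le_antisymm (hc i) (hv.nonneg_left i)
  obtain ⟨i, hi | hi⟩ := h0
  · exact hi (hf i)
  · have hir : i < r := by
      by_contra! hir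
      exact hi (hv.right_eq_zero i hir)
    have hs := hv.sum_eq
    rw [sum_eq_zero fun i _ => hf i] at hs
    exact hi ((sum_eq_zero_iff_of_nonneg fun i _ => hv.nonneg_right i).1 hs.symm i
      (mem_range.2 hir))

lemma isExtremalRayOfKostka_iff {r : ℕ} (R : Set ((Fin r → ℝ) × (Fin r → ℝ))) :
    IsExtremalRayOfKostka r R ↔
      ∃ l m n, IsRayIndex r l m n ∧ openRay (generator r l m n) = R := by
  constructor
  · rintro ⟨v, hv, hv0, hext, rfl⟩
    have hv' := (inKostkaCone_iff _ _).1 hv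
    have hne : ∃ i, zeroExtend v.1 i ≠ 0 ∨ zeroExtend v.2 i ≠ 0 := by
      by_contra! hc
      exact hv0 (Prod.ext (funext fun i => by simpa [zeroExtend_val] using (hc i).1)
        (funext fun i => by simpa [zeroExtend_val] using (hc i).2))
    obtain ⟨l, m, n, h, ε, hε, hsub⟩ := hv'.exists_sub_ray (hv'.exists_pos hne)
    refine ⟨l, m, n, h, ?_⟩
    have hg := h.kostkaPair
    have hscale : InKostkaCone r (ε • generator r l m n).1 (ε • generator r l m n).2 := by
      obtain ⟨a, b, c, d, e, k⟩ := h.inKostkaCone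
      simp only [InKostkaCone, Prod.smul_fst, Prod.smul_snd, Pi.smul_apply, smul_eq_mul,
        ← mul_ite_zero, ← mul_sum, mul_le_mul_iff_right₀ hε, mul_right_inj' hε.ne']
      exact ⟨a, b, fun i => mul_nonneg hε.le (c i), fun i => mul_nonneg hε.le (d i), e, k⟩
    have hrest : InKostkaCone r (v - ε • generator r l m n).1 (v - ε • generator r l m n).2 := by
      rw [inKostkaCone_iff]
      convert hsub using 1
      · rw [← zeroExtend_restrict _ hsub.left_eq_zero]
        congr 1
        ext i
        simp [zeroExtend_val, generator]
      · rw [← zeroExtend_restrict _ hsub.right_eq_zero]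
        congr 1
        ext i
        simp [zeroExtend_val, generator]
    obtain ⟨c, hc, hcv⟩ := hext _ _ hscale hrest (by abel)
    have hc0 : c ≠ 0 := by
      rintro rfl
      rw [zero_smul, smul_eq_zero] at hcv
      exact hcv.elim hε.ne' h.generator_ne_zero
    rw [← openRay_smul _ hε, hcv, openRay_smul _ (lt_of_le_of_ne hc hc0.symm)]
    rfl
  · rintro ⟨l, m, n, h, rfl⟩
    exact h.isExtremalRay

lemma eq_of_lt_iff_lt {r a b : ℕ} (ha : a ≤ r) (hb : b ≤ r) (h : ∀ i < r, i < a ↔ i < b) :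
    a = b := by
  by_contra hne
  rcases lt_or_gt_of_ne hne with hlt | hlt
  · exact lt_irrefl _ ((h a (by omega)).2 hlt)
  · exact lt_irrefl _ ((h b (by omega)).1 hlt)

lemma openRay_generator_injective {r l m n l' m' n' : ℕ} (h : IsRayIndex r l m n)
    (h' : IsRayIndex r l' m' n')
    (heq : openRay (generator r l m n) = openRay (generator r l' m' n')) :
    l = l' ∧ m = m' ∧ n = n' := by
  have hmem : generator r l m n ∈ openRay (generator r l' m' n') :=
    heq ▸ ⟨1, one_pos, (one_smul _ _).symm⟩
  obtain ⟨c, -, hc⟩ := hmem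
  have h1 : ∀ i < r, weight m i = c * weight m' i := fun i hi =>
    congrFun (congrArg Prod.fst hc) ⟨i, hi⟩
  have h2 : ∀ i < r, interp l m n i = c * interp l' m' n' i := fun i hi =>
    congrFun (congrArg Prod.snd hc) ⟨i, hi⟩
  have hc1 : c = 1 := by
    have := h1 0 h.pos
    simpa [weight, h.1, h'.1] using this.symm
  simp only [hc1, one_mul] at h1 h2
  have hi := h.2
  have hi' := h'.2
  refine ⟨eq_of_lt_iff_lt (r := r) (by omega) (by omega) fun i hi => ?_,
    eq_of_lt_iff_lt (r := r) (by omega) (by omega) fun i hi => ?_,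
    eq_of_lt_iff_lt (r := r) (by omega) (by omega) fun i hi => ?_⟩
  · rw [← h.interp_eq_one_iff, ← h'.interp_eq_one_iff, h2 i hi]
  · have := h1 i hi
    simp only [weight] at this
    split_ifs at this with a b b <;> simp [a, b] at this ⊢
  · rw [← h.interp_pos_iff, ← h'.interp_pos_iff, h2 i hi]

lemma card_isRayIndex (r : ℕ) :
    {p : ℕ × ℕ × ℕ | IsRayIndex r p.1 p.2.1 p.2.2}.ncard =
      r.choose 3 + r.choose 2 + r.choose 1 := by
  let S : Finset (Σ _ : ℕ, Σ _ : ℕ, ℕ) :=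
    (range (r + 1)).sigma fun n => (range n).sigma fun m => range m
  let e : (Σ _ : ℕ, Σ _ : ℕ, ℕ) → ℕ × ℕ × ℕ := fun p => (p.2.2, p.2.1, p.1)
  have he : Function.Injective e := by
    rintro ⟨a, b, c⟩ ⟨a', b', c'⟩ h
    simp only [e, Prod.mk.injEq] at h
    obtain ⟨rfl, rfl, rfl⟩ := h
    rfl
  let d : ℕ → ℕ × ℕ × ℕ := fun m => (m + 1, m + 1, m + 1)
  have hd : Function.Injective d := fun a b h => by simpa [d] using h
  have hset : {p : ℕ × ℕ × ℕ | IsRayIndex r p.1 p.2.1 p.2.2} =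
      ((S.image e ∪ (range r).image d : Finset (ℕ × ℕ × ℕ)) : Set (ℕ × ℕ × ℕ)) := by
    ext ⟨l, m, n⟩
    simp only [IsRayIndex, Set.mem_ofPred_eq, coe_union, coe_image, Set.mem_union, Set.mem_image,
      mem_coe, S, e, d, mem_sigma, mem_range, Prod.mk.injEq, Sigma.exists]
    constructor
    · rintro ⟨h0, hr, ⟨h1, h2⟩ | ⟨rfl, rfl⟩⟩
      · exact Or.inl ⟨n, m, l, ⟨by omega, h2, h1⟩, rfl, rfl, rfl⟩
      · exact Or.inr ⟨l - 1, by omega, by omega, by omega, by omega⟩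
    · rintro (⟨n, m, l, h, rfl, rfl, rfl⟩ | ⟨k, h, rfl, rfl, rfl⟩) <;> omega
  have hdisj : Disjoint (S.image e) ((range r).image d) := by
    rw [disjoint_left]
    intro p hp hp'
    simp only [mem_image, S, e, d, mem_sigma, mem_range] at hp hp'
    obtain ⟨⟨n, m, l⟩, h, rfl⟩ := hp
    obtain ⟨k, hk, h'⟩ := hp'
    simp only [Prod.mk.injEq] at h h'
    omega
  have hS : ∀ k, ∑ n ∈ range (k + 1), ∑ m ∈ range n, m = (k + 1).choose 3 := by
    intro k
    induction k with
    | zero => rfl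
    | succ k ih =>
      rw [sum_range_succ, ih, sum_range_id, ← Nat.choose_two_right, add_comm]
      exact (Nat.choose_succ_succ (k + 1) 2).symm
  rw [hset, Set.ncard_coe_finset, card_union_of_disjoint hdisj, card_image_of_injective _ he,
    card_image_of_injective _ hd]
  simp only [S, card_sigma, card_range]
  rw [hS, Nat.choose_succ_succ, Nat.choose_one_right]
  ring

/-- the number of extremal rays of `Kostka_r` is `C(r,3) + C(r,2) + C(r,1)`. -/
theorem stmt8 (r : ℕ) :
    Nat.card {R : Set ((Fin r → ℝ) × (Fin r → ℝ)) // IsExtremalRayOfKostka r R} =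
      r.choose 3 + r.choose 2 + r.choose 1 := by
  have hset : {R : Set ((Fin r → ℝ) × (Fin r → ℝ)) | IsExtremalRayOfKostka r R} =
      (fun p : ℕ × ℕ × ℕ => openRay (generator r p.1 p.2.1 p.2.2)) ''
        {p | IsRayIndex r p.1 p.2.1 p.2.2} := by
    ext R
    simp [isExtremalRayOfKostka_iff]
  rw [← card_isRayIndex r]
  change Set.ncard {R : Set ((Fin r → ℝ) × (Fin r → ℝ)) | IsExtremalRayOfKostka r R} = _
  rw [hset]
  apply Set.InjOn.ncard_image
  rintro ⟨l, m, n⟩ h ⟨l', m', n'⟩ h' heq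
  obtain ⟨rfl, rfl, rfl⟩ := openRay_generator_injective h h' heq
  rfl
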